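/- Let p ∈ (1,∞) and let m be a positive integer. There exist positive constants K₁ = K₁(p,m) and K₃ = K₃(p,m) with K₃ < 1/2 (given by explicit formulas) such that the following holds. Let f be a function on I = (0,1) with ‖f‖_∞ = 1 of the form f = h·φ, where h is positive, concave and differentiable on I and φ is positive and (1/m)-concave on I. If μ_p(I,f) ≤ π_p^p + 1, then μ_p(I,f) ≥ π_p^p + K₁·min_{x ∈ [K₃, 1−K₃]} (h′(x)/h(x))². -/

import Mathlib

open MeasureTheory Set Filter Topology

/-- `π_p := 2π (p-1)^{1/p} / (p sin(π/p))`. -/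
noncomputable def piP (p : ℝ) : ℝ :=
  2 * Real.pi * (p - 1) ^ (1 / p) / (p * Real.sin (Real.pi / p))

/-- The first nontrivial Neumann `p`-Laplacian eigenvalue of a one-dimensional set `I ⊆ ℝ`
with weight `f`. -/
noncomputable def muP1 (p : ℝ) (I : Set ℝ) (f : ℝ → ℝ) : ℝ :=
  sInf { r : ℝ | ∃ (u : ℝ → ℝ) (K : NNReal),
    LipschitzWith K u ∧
    ¬ (∀ᵐ x ∂(volume.restrict I), u x = 0) ∧
    (∫ x in I, f x * |u x| ^ (p - 2) * u x) = 0 ∧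
    r = (∫ x in I, f x * |deriv u x| ^ p) / (∫ x in I, f x * |u x| ^ p) }

theorem young_mul_le {p a b : ℝ} (hp : 1 < p) (ha : 0 ≤ a) (hb : 0 ≤ b) :
    p * (a * b) ≤ a ^ p + (p - 1) * b ^ (p / (p - 1)) := by
  have hpq := Real.HolderConjugate.conjExponent hp
  have h := Real.young_inequality_of_nonneg ha hb hpq
  have hp0 : 0 < p := by linarith
  have hp1 : 0 < p - 1 := by linarith
  rw [Real.conjExponent] at h
  have h2 := mul_le_mul_of_nonneg_left h hp0.le
  have : p * (a ^ p / p + b ^ (p / (p - 1)) / (p / (p - 1)))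
      = a ^ p + (p - 1) * b ^ (p / (p - 1)) := by
    field_simp
  linarith

theorem rpow_sub_one_rpow_conj {p x : ℝ} (hp : 1 < p) (hx : 0 ≤ x) :
    (x ^ (p - 1)) ^ (p / (p - 1)) = x ^ p := by
  have hp1 : p - 1 ≠ 0 := by linarith
  rw [← Real.rpow_mul hx, mul_div_cancel₀ _ hp1]

theorem abs_rpow_sub_two_mul_self {p : ℝ} (hp : 1 < p) (x : ℝ) :
    |x| ^ (p - 2) * x * x = |x| ^ p := by
  rcases eq_or_ne x 0 with rfl | hx
  · simp [Real.zero_rpow (by linarith : p ≠ 0)]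
  · have hx' : 0 < |x| := abs_pos.2 hx
    rw [mul_assoc, ← abs_mul_abs_self x, ← pow_two, ← Real.rpow_natCast |x| 2,
      ← Real.rpow_add hx']
    norm_num

theorem abs_abs_rpow_sub_two_mul {p : ℝ} (hp : 1 < p) (x : ℝ) :
    |(|x| ^ (p - 2) * x)| = |x| ^ (p - 1) := by
  rcases eq_or_ne x 0 with rfl | hx
  · simp [Real.zero_rpow (by linarith : p - 1 ≠ 0)]
  · have hx' : 0 < |x| := abs_pos.2 hx
    rw [abs_mul, abs_of_nonneg (by positivity)]
    nth_rewrite 2 [← Real.rpow_one |x|]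
    rw [← Real.rpow_add hx']
    ring_nf

/-- The tangent line inequality for `|·|^p`. -/
theorem abs_rpow_tangent_le {p : ℝ} (hp : 1 < p) (x c : ℝ) :
    |x| ^ p - p * c * (|x| ^ (p - 2) * x) ≤ |x - c| ^ p := by
  have h := young_mul_le hp (abs_nonneg (x - c)) (Real.rpow_nonneg (abs_nonneg x) (p - 1))
  rw [rpow_sub_one_rpow_conj hp (abs_nonneg x)] at h
  have h1 : |x| ^ (p - 2) * x * (x - c) ≤ |x - c| * |x| ^ (p - 1) := by
    calc _ ≤ |(|x| ^ (p - 2) * x * (x - c))| := le_abs_self _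
      _ = _ := by rw [abs_mul, abs_abs_rpow_sub_two_mul hp, mul_comm]
  have h2 := abs_rpow_sub_two_mul_self hp x
  have h3 := mul_le_mul_of_nonneg_left h1 (by linarith : 0 ≤ p)
  have h4 : p * (|x| ^ (p - 2) * x * (x - c)) = p * |x| ^ p - p * c * (|x| ^ (p - 2) * x) := by
    rw [← h2]; ring
  linarith

theorem continuous_abs_rpow_sub_two_mul {p : ℝ} (hp : 1 < p) :
    Continuous fun x : ℝ => |x| ^ (p - 2) * x := by
  rw [continuous_iff_continuousAt]
  intro x
  rcases eq_or_ne x 0 with rfl | hx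
  · have : Tendsto (fun x : ℝ => |(|x| ^ (p - 2) * x)|) (𝓝 0) (𝓝 0) := by
      simp_rw [abs_abs_rpow_sub_two_mul hp]
      have : ContinuousAt (fun x : ℝ => |x| ^ (p - 1)) 0 :=
        (continuous_abs.continuousAt).rpow_const (Or.inr (by linarith))
      simpa [ContinuousAt, Real.zero_rpow (by linarith : p - 1 ≠ 0)] using this
    simpa [ContinuousAt] using (tendsto_zero_iff_abs_tendsto_zero _).2 this
  · exact ((continuous_abs.continuousAt).rpow_const (Or.inl (abs_pos.2 hx).ne')).mul
      continuousAt_id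

/-- Autonomous scalar flows with a bounded, uniformly positive continuous speed. -/
theorem exists_autonomous_flow {B : ℝ → ℝ} (hB : Continuous B) {b M : ℝ} (hb : 0 < b)
    (hbB : ∀ s, b ≤ B s) (hBM : ∀ s, B s ≤ M) :
    ∃ g : ℝ → ℝ, g 0 = 0 ∧ StrictMono g ∧ (∀ x, HasDerivAt g (B (g x)) x) ∧
      ∀ y, g (∫ s in (0 : ℝ)..y, (B s)⁻¹) = y := by
  have hpos : ∀ s, 0 < B s := fun s => hb.trans_le (hbB s)
  have hM : 0 < M := (hpos 0).trans_le (hBM 0)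
  have hinv : Continuous fun s => (B s)⁻¹ := hB.inv₀ fun s => (hpos s).ne'
  set T : ℝ → ℝ := fun y => ∫ s in (0 : ℝ)..y, (B s)⁻¹ with hT
  have hTd : ∀ y, HasDerivAt T (B y)⁻¹ y := fun y =>
    intervalIntegral.integral_hasDerivAt_right (hinv.intervalIntegrable _ _)
      (hinv.stronglyMeasurableAtFilter _ _) hinv.continuousAt
  have hTm : StrictMono T := strictMono_of_hasDerivAt_pos hTd fun y => inv_pos.2 (hpos y)
  have hTc : Continuous T := continuous_iff_continuousAt.2 fun y => (hTd y).continuousAt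
  have hmono : Monotone fun y => T y - M⁻¹ * y := by
    apply monotone_of_hasDerivAt_nonneg (f' := fun y => (B y)⁻¹ - M⁻¹ * 1)
    · intro y
      exact (hTd y).sub ((hasDerivAt_id y).const_mul _)
    · intro y
      have := inv_anti₀ (hpos y) (hBM y)
      simpa using this
  have hT0 : T 0 = 0 := by simp [hT]
  have hsurj : Function.Surjective T := by
    apply hTc.surjective
    · apply tendsto_atTop_mono' _ _ (tendsto_id.const_mul_atTop (inv_pos.2 hM))
      filter_upwards [eventually_ge_atTop 0] with y hy
      have := hmono hy
      simp [hT0] at this ⊢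
      exact this
    · apply tendsto_atBot_mono' _ _ (tendsto_id.const_mul_atBot (inv_pos.2 hM))
      filter_upwards [eventually_le_atBot 0] with y hy
      have := hmono hy
      simp [hT0] at this ⊢
      exact this
  let e := hTm.orderIsoOfSurjective T hsurj
  have hr : ∀ x, T (e.symm x) = x := fun x => e.apply_symm_apply x
  have hl : ∀ y, e.symm (T y) = y := fun y => e.symm_apply_apply y
  refine ⟨e.symm, ?_, e.symm.strictMono, fun x => ?_, hl⟩
  · have := hl 0
    rwa [hT0] at this
  · have := HasDerivAt.of_local_left_inverse (f := T) (g := e.symm) (a := x)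
      e.symm.continuous.continuousAt (hTd _) (inv_ne_zero (hpos _).ne')
      (Eventually.of_forall hr)
    simpa using this

theorem lintegral_inv_add_rpow {p l : ℝ} (hp : 1 < p) (hl : 0 < l) :
    ∫⁻ s in Ioi (0 : ℝ), ENNReal.ofReal (l + (p - 1) * s ^ (p / (p - 1)))⁻¹
      = ENNReal.ofReal (l ^ (-(1 / p)) * (piP p / 2)) := by
  have hp1 : 0 < p - 1 := by linarith
  have hp0 : 0 < p := by linarith
  set q := p / (p - 1) with hq
  have hq0 : 0 < q := by positivity
  have hinv : ∀ a : ℝ, 0 < a → ENNReal.ofReal a⁻¹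
      = ∫⁻ t in Ioi (0 : ℝ), ENNReal.ofReal (Real.exp (-(a * t))) := by
    intro a ha
    have h1 : ∫ t in Ioi (0 : ℝ), Real.exp (-(a * t)) = a⁻¹ := by
      have := Real.integral_rpow_mul_exp_neg_mul_Ioi (a := 1) (r := a) one_pos ha
      simpa using this
    rw [← h1, ofReal_integral_eq_lintegral_ofReal]
    · by_contra hcon
      rw [integral_undef hcon] at h1
      exact (inv_pos.2 ha).ne h1
    · exact Eventually.of_forall fun t => (Real.exp_pos _).le
  have hA : ∀ s ∈ Ioi (0 : ℝ), 0 < l + (p - 1) * s ^ q := by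
    intro s hs
    have : 0 < s ^ q := Real.rpow_pos_of_pos hs _
    positivity
  have h1 : ∫⁻ s in Ioi (0 : ℝ), ENNReal.ofReal (l + (p - 1) * s ^ q)⁻¹
      = ∫⁻ s in Ioi (0 : ℝ), ∫⁻ t in Ioi (0 : ℝ),
        ENNReal.ofReal (Real.exp (-((l + (p - 1) * s ^ q) * t))) :=
    setLIntegral_congr_fun measurableSet_Ioi fun s hs => hinv _ (hA s hs)
  rw [h1, lintegral_lintegral_swap (by
    apply Measurable.aemeasurable
    unfold Function.uncurry
    fun_prop)]
  have h2 : ∀ t ∈ Ioi (0 : ℝ), ∫⁻ s in Ioi (0 : ℝ),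
        ENNReal.ofReal (Real.exp (-((l + (p - 1) * s ^ q) * t)))
      = ENNReal.ofReal ((p - 1) ^ (-1 / q) * Real.Gamma (1 / q + 1) *
          (t ^ ((1 - 1 / q) - 1) * Real.exp (-(l * t)))) := by
    intro t ht
    have ht' : 0 < (p - 1) * t := mul_pos hp1 ht
    have hI := integral_exp_neg_mul_rpow hq0 ht'
    have hI' : ∫ s in Ioi (0 : ℝ), Real.exp (-((l + (p - 1) * s ^ q) * t))
        = (p - 1) ^ (-1 / q) * Real.Gamma (1 / q + 1) *
          (t ^ ((1 - 1 / q) - 1) * Real.exp (-(l * t))) := by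
      have : ∀ s : ℝ, Real.exp (-((l + (p - 1) * s ^ q) * t))
          = Real.exp (-(l * t)) * Real.exp (-((p - 1) * t) * s ^ q) := by
        intro s
        rw [← Real.exp_add]
        ring_nf
      simp_rw [this]
      rw [integral_const_mul, hI, Real.mul_rpow hp1.le (le_of_lt ht)]
      have : (1 - 1 / q) - 1 = -1 / q := by ring
      rw [this]
      ring
    rw [← hI', ofReal_integral_eq_lintegral_ofReal]
    · by_contra hcon
      rw [integral_undef hcon] at hI'
      have ht2 : (0 : ℝ) < t := ht
      have : 0 < Real.Gamma (1 / q + 1) := Real.Gamma_pos_of_pos (by positivity)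
      exact absurd hI' (by positivity)
    · exact Eventually.of_forall fun t => (Real.exp_pos _).le
  rw [setLIntegral_congr_fun measurableSet_Ioi h2]
  have hq1 : 1 / q = (p - 1) / p := by rw [hq]; field_simp
  have hq2 : 1 - 1 / q = 1 / p := by rw [hq1]; field_simp; ring
  have hJ := Real.integral_rpow_mul_exp_neg_mul_Ioi (a := 1 - 1 / q) (r := l)
    (by rw [hq2]; positivity) hl
  have hΓ : Real.Gamma (1 / q + 1) * Real.Gamma (1 - 1 / q)
      = (p - 1) / p * (Real.pi / Real.sin (Real.pi / p)) := by
    rw [Real.Gamma_add_one (by positivity), mul_assoc, Real.Gamma_mul_Gamma_one_sub]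
    have : Real.sin (Real.pi * (1 / q)) = Real.sin (Real.pi / p) := by
      rw [← Real.sin_pi_sub, hq1]
      congr 1
      field_simp
      ring
    rw [this, hq1]
  have hJ' : ∫ t in Ioi (0 : ℝ), (p - 1) ^ (-1 / q) * Real.Gamma (1 / q + 1) *
          (t ^ ((1 - 1 / q) - 1) * Real.exp (-(l * t)))
      = l ^ (-(1 / p)) * (piP p / 2) := by
    rw [integral_const_mul, hJ, hq2, ← hq2, one_div l, Real.inv_rpow hl.le, hq2,
      ← Real.rpow_neg hl.le]
    have e1 : (p - 1) ^ (-1 / q) * (p - 1) = (p - 1) ^ (1 / p) := by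
      nth_rewrite 2 [← Real.rpow_one (p - 1)]
      rw [← Real.rpow_add hp1]
      congr 1
      rw [← hq2]; ring
    rw [← hq2] 
    calc _ = l ^ (-(1 - 1 / q)) * ((p - 1) ^ (-1 / q) *
          (Real.Gamma (1 / q + 1) * Real.Gamma (1 - 1 / q))) := by ring
      _ = _ := by
        rw [hΓ, piP, ← e1]
        ring
  rw [← hJ', ofReal_integral_eq_lintegral_ofReal]
  · apply Integrable.const_mul
    by_contra hcon
    rw [integral_undef hcon] at hJ
    have : 0 < Real.Gamma (1 - 1 / q) := Real.Gamma_pos_of_pos (by rw [hq2]; positivity)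
    exact absurd hJ (by positivity)
  · filter_upwards [self_mem_ae_restrict measurableSet_Ioi] with t ht
    have ht2 : (0 : ℝ) < t := ht
    have : 0 < Real.Gamma (1 / q + 1) := Real.Gamma_pos_of_pos (by positivity)
    positivity

theorem piP_pos {p : ℝ} (hp : 1 < p) : 0 < piP p := by
  have hp1 : 0 < p - 1 := by linarith
  have hp0 : 0 < p := by linarith
  have : 0 < Real.sin (Real.pi / p) := by
    apply Real.sin_pos_of_pos_of_lt_pi
    · positivity
    · exact div_lt_self Real.pi_pos hp
  unfold piP
  positivity

theorem tendsto_integral_inv_add_rpow {p l : ℝ} (hp : 1 < p) (hl : 0 < l) :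
    Tendsto (fun Y : ℝ => ∫ s in (0 : ℝ)..Y, (l + (p - 1) * s ^ (p / (p - 1)))⁻¹) atTop
      (𝓝 (l ^ (-(1 / p)) * (piP p / 2))) := by
  have hp1 : 0 < p - 1 := by linarith
  have hpi := piP_pos hp
  have h := lintegral_inv_add_rpow hp hl
  have hnn : 0 ≤ᵐ[volume.restrict (Ioi (0 : ℝ))]
      fun s => (l + (p - 1) * s ^ (p / (p - 1)))⁻¹ := by
    filter_upwards [self_mem_ae_restrict measurableSet_Ioi] with s hs
    have hs' : (0 : ℝ) < s := hs
    simp only [Pi.zero_apply]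
    positivity
  have hm : Measurable fun s : ℝ => (l + (p - 1) * s ^ (p / (p - 1)))⁻¹ := by fun_prop
  have hintegrable : IntegrableOn (fun s : ℝ => (l + (p - 1) * s ^ (p / (p - 1)))⁻¹) (Ioi 0) := by
    refine ⟨hm.aestronglyMeasurable, ?_⟩
    rw [hasFiniteIntegral_iff_ofReal hnn, h]
    exact ENNReal.ofReal_lt_top
  have heq : ∫ s in Ioi (0 : ℝ), (l + (p - 1) * s ^ (p / (p - 1)))⁻¹
      = l ^ (-(1 / p)) * (piP p / 2) := by
    rw [integral_eq_lintegral_of_nonneg_ae hnn hm.aestronglyMeasurable, h,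
      ENNReal.toReal_ofReal (by positivity)]
  rw [← heq]
  exact intervalIntegral_tendsto_integral_Ioi 0 hintegrable tendsto_id

/-- Positive locally Lipschitz weights on `(0, 1)` bounded by `1`. -/
structure IsUnitWeight (f : ℝ → ℝ) : Prop where
  pos : ∀ x ∈ Ioo (0 : ℝ) 1, 0 < f x
  le_one : ∀ x ∈ Ioo (0 : ℝ) 1, f x ≤ 1
  locallyLipschitzOn : LocallyLipschitzOn (Ioo 0 1) f

/-- The Poincaré inequality with constant `l` on `(0, a)` for `u - u a`, with weight `f`. -/
def PoincareAt (p l : ℝ) (f u : ℝ → ℝ) (a : ℝ) : Prop :=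
  l * ∫ x in (0 : ℝ)..a, f x * |u x - u a| ^ p ≤ ∫ x in (0 : ℝ)..a, f x * |deriv u x| ^ p

/-- The logarithmic derivative of `f` is at least `D` on `(0, a)`, wherever it exists. -/
def LogDerivGE (f : ℝ → ℝ) (a : ℝ) (D : ℝ → ℝ) : Prop :=
  ∀ x ∈ Ioo 0 a, ∀ d, HasDerivAt f d x → D x * f x ≤ d

theorem integrableOn_weight_mul {f v : ℝ → ℝ} {C : ℝ}
    (hf : IsUnitWeight f) (hv : Measurable v)
    (hvC : ∀ x ∈ Ioo (0 : ℝ) 1, |v x| ≤ C) :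
    IntegrableOn (fun x => f x * v x) (Ioo 0 1) := by
  refine Integrable.of_bound
    ((hf.locallyLipschitzOn.continuousOn.aestronglyMeasurable measurableSet_Ioo).mul
      hv.aestronglyMeasurable) C ?_
  filter_upwards [self_mem_ae_restrict measurableSet_Ioo] with x hx
  rw [norm_mul, Real.norm_eq_abs, Real.norm_eq_abs, abs_of_pos (hf.pos x hx)]
  calc f x * |v x| ≤ 1 * |v x| := by gcongr; exact hf.le_one x hx
    _ ≤ C := by rw [one_mul]; exact hvC x hx

theorem intervalIntegrable_of_integrableOn_Ioo {F : ℝ → ℝ} (hF : IntegrableOn F (Ioo 0 1))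
    {a b : ℝ} (ha : a ∈ Icc (0 : ℝ) 1) (hb : b ∈ Icc (0 : ℝ) 1) :
    IntervalIntegrable F volume a b := by
  have h : IntervalIntegrable F volume 0 1 :=
    (intervalIntegrable_iff_integrableOn_Ioo_of_le zero_le_one).2 hF
  apply h.mono_set
  rw [uIcc_of_le zero_le_one]
  exact uIcc_subset_Icc ha hb

theorem integrableOn_weight_mul_deriv {p : ℝ} {f u : ℝ → ℝ} {K : NNReal} (hp : 1 < p)
    (hf : IsUnitWeight f) (hu : LipschitzWith K u) :
    IntegrableOn (fun x => f x * |deriv u x| ^ p) (Ioo 0 1) := by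
  apply integrableOn_weight_mul (C := (K : ℝ) ^ p) hf
  · exact ((measurable_deriv u).abs).pow_const p
  · intro x _
    rw [abs_of_nonneg (by positivity)]
    exact Real.rpow_le_rpow (abs_nonneg _) (norm_deriv_le_of_lipschitz hu) (by linarith)

theorem integrableOn_weight_mul_continuous {f v : ℝ → ℝ}
    (hf : IsUnitWeight f) (hv : Continuous v) :
    IntegrableOn (fun x => f x * v x) (Ioo 0 1) := by
  obtain ⟨C, hC⟩ := isCompact_Icc.exists_bound_of_continuousOn (s := Icc (0 : ℝ) 1) hv.continuousOn
  exact integrableOn_weight_mul hf hv.measurable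
    fun x hx => hC x (Ioo_subset_Icc_self hx)

theorem continuous_abs_rpow {p : ℝ} (hp : 1 < p) {v : ℝ → ℝ} (hv : Continuous v) :
    Continuous fun x => |v x| ^ p :=
  hv.abs.rpow_const fun _ => Or.inr (by linarith)

/-- A nonnegative supersolution `g` of the Riccati equation attached to the weight `f` on `(0, a)`
gives a weighted Poincaré inequality for functions vanishing at `a`. -/
theorem poincare_of_riccati {p l a : ℝ} {f u g g' : ℝ → ℝ} {K : NNReal} (hp : 1 < p)
    (ha : a ∈ Ioo (0 : ℝ) 1)
    (hf : IsUnitWeight f) (hu : LipschitzWith K u)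
    (hg : ∀ x, HasDerivAt g (g' x) x) (hg' : Continuous g')
    (hg0 : ∀ x ∈ Ioo 0 a, 0 ≤ g x)
    (hric : ∀ x ∈ Ioo 0 a, ∀ d, HasDerivAt f d x →
      f x * (l + (p - 1) * g x ^ (p / (p - 1))) ≤ d * g x + f x * g' x) :
    PoincareAt p l f u a := by
  have hp0 : 0 < p := by linarith
  have hwc : Continuous fun x => u x - u a := hu.continuous.sub continuous_const
  have hI1 := integrableOn_weight_mul_deriv hp hf hu
  have hI2 := integrableOn_weight_mul_continuous hf (continuous_abs_rpow hp hwc)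
  have hI : IntegrableOn (fun x => l * (f x * |u x - u a| ^ p) - f x * |deriv u x| ^ p)
    (Ioo 0 1) := (hI2.const_mul l).sub hI1
  have ha01 : a ∈ Icc (0 : ℝ) 1 := Ioo_subset_Icc_self ha
  have h0 : (0 : ℝ) ∈ Icc (0 : ℝ) 1 := by simp
  -- the inequality on `(ε, a)`
  have key : ∀ ε ∈ Ioo 0 a,
      ∫ x in ε..a, (l * (f x * |u x - u a| ^ p) - f x * |deriv u x| ^ p) ≤ 0 := by
    intro ε hε
    have hε01 : ε ∈ Icc (0 : ℝ) 1 := ⟨hε.1.le, hε.2.le.trans ha01.2⟩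
    have hsub : Icc ε a ⊆ Ioo 0 1 := fun x hx =>
      ⟨hε.1.trans_le hx.1, hx.2.trans_lt ha.2⟩
    have hfAC : AbsolutelyContinuousOnInterval f ε a := by
      obtain ⟨C, hC⟩ := (hf.locallyLipschitzOn.mono hsub).exists_lipschitzOnWith_of_compact
        isCompact_Icc
      rw [← uIcc_of_le hε.2.le] at hC
      exact hC.absolutelyContinuousOnInterval
    have hgAC : AbsolutelyContinuousOnInterval g ε a := by
      apply ContDiffOn.absolutelyContinuousOnInterval
      apply ContDiff.contDiffOn
      rw [contDiff_one_iff_deriv]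
      refine ⟨fun x => (hg x).differentiableAt, ?_⟩
      rwa [show deriv g = g' from funext fun x => (hg x).deriv]
    have hwAC : AbsolutelyContinuousOnInterval (fun x => |u x - u a| ^ p) ε a := by
      have h1 : LocallyLipschitz fun y : ℝ => ‖y‖ ^ p :=
        (contDiff_norm_rpow hp).locallyLipschitz
      have h2 : LocallyLipschitz fun x => u x - u a :=
        hu.locallyLipschitz.sub (LocallyLipschitz.const _)
      obtain ⟨C, hC⟩ := ((h1.comp h2).locallyLipschitzOn
        (s := uIcc ε a)).exists_lipschitzOnWith_of_compact isCompact_uIcc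
      exact hC.absolutelyContinuousOnInterval
    have hFAC : AbsolutelyContinuousOnInterval (fun x => f x * g x * |u x - u a| ^ p) ε a :=
      (hfAC.fun_mul hgAC).fun_mul hwAC
    have hFTC := hFAC.integral_deriv_eq_sub
    simp only [sub_self, abs_zero, Real.zero_rpow hp0.ne', mul_zero, zero_sub] at hFTC
    have hFε : 0 ≤ f ε * g ε * |u ε - u a| ^ p := by
      have := hf.pos ε (hsub ⟨le_rfl, hε.2.le⟩)
      have := hg0 ε hε
      positivity
    have hmono : ∫ x in ε..a, (l * (f x * |u x - u a| ^ p) - f x * |deriv u x| ^ p)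
        ≤ ∫ x in ε..a, deriv (fun x => f x * g x * |u x - u a| ^ p) x := by
      apply intervalIntegral.integral_mono_ae_restrict hε.2.le
        (intervalIntegrable_of_integrableOn_Ioo hI hε01 ha01) hFAC.intervalIntegrable_deriv
      have hae1 := ae_restrict_of_ae (s := Icc ε a) hfAC.ae_differentiableAt
      have hae2 := ae_restrict_of_ae (s := Icc ε a) hu.ae_differentiableAt_real
      have hae3 : ∀ᵐ x ∂(volume.restrict (Icc ε a)), x ≠ a :=
        ae_restrict_of_ae (by simp [ae_iff])
      filter_upwards [hae1, hae2, hae3, self_mem_ae_restrict measurableSet_Icc]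
        with x hx1 hx2 hx3 hx
      have hxa : x ∈ Ioo 0 a := ⟨hε.1.trans_le hx.1, lt_of_le_of_ne hx.2 hx3⟩
      have hfx : 0 < f x := hf.pos x (hsub hx)
      have hgx : 0 ≤ g x := hg0 x hxa
      rw [uIcc_of_le hε.2.le] at hx1
      have hdf := (hx1 hx).hasDerivAt
      have hdu := hx2.hasDerivAt
      have hdw : HasDerivAt (fun x => |u x - u a| ^ p)
          (p * |u x - u a| ^ (p - 2) * (u x - u a) * deriv u x) x :=
        HasDerivAt.comp (h₂ := fun y : ℝ => |y| ^ p) (h := fun x => u x - u a) x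
          (hasDerivAt_abs_rpow (u x - u a) hp) (hdu.sub_const (u a))
      have hd := (hdf.mul (hg x)).mul hdw
      have hd' := hd.deriv
      simp only [Pi.mul_def] at hd'
      rw [hd']
      set w := u x - u a
      have hW : 0 ≤ |w| ^ p := by positivity
      have h1 := mul_le_mul_of_nonneg_right (hric x hxa _ hdf) hW
      have h2 := young_mul_le hp (abs_nonneg (deriv u x))
        (mul_nonneg hgx (Real.rpow_nonneg (abs_nonneg w) (p - 1)))
      rw [Real.mul_rpow hgx (by positivity), rpow_sub_one_rpow_conj hp (abs_nonneg w)] at h2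
      have h3 : -(|w| ^ (p - 1) * |deriv u x|) ≤ |w| ^ (p - 2) * w * deriv u x := by
        rw [← abs_abs_rpow_sub_two_mul hp, ← abs_mul]
        exact neg_abs_le _
      have h4 := mul_le_mul_of_nonneg_left h3 (by positivity : 0 ≤ f x * g x * p)
      have h5 := mul_le_mul_of_nonneg_left h2 hfx.le
      linarith
    linarith
  have hlim : Tendsto (fun ε => ∫ x in ε..a, (l * (f x * |u x - u a| ^ p)
      - f x * |deriv u x| ^ p)) (𝓝[>] 0)
      (𝓝 (∫ x in (0 : ℝ)..a, (l * (f x * |u x - u a| ^ p) - f x * |deriv u x| ^ p))) := by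
    have hcont := intervalIntegral.continuousOn_primitive_interval_left (μ := volume)
      (a := 0) (b := a) (f := fun x => l * (f x * |u x - u a| ^ p) - f x * |deriv u x| ^ p) (by
        rw [uIcc_of_le ha.1.le, integrableOn_Icc_iff_integrableOn_Ioo]
        exact hI.mono_set (Ioo_subset_Ioo le_rfl ha01.2))
    have := hcont 0 (by simp)
    rw [uIcc_of_le ha.1.le] at this
    exact this.mono_left (nhdsWithin_le_iff.2 (Icc_mem_nhdsGT ha.1))
  have hfin := le_of_tendsto hlim (by
    filter_upwards [Ioo_mem_nhdsGT ha.1] with ε hε using key ε hε)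
  rw [intervalIntegral.integral_sub
    ((intervalIntegrable_of_integrableOn_Ioo hI2 h0 ha01).const_mul l)
    (intervalIntegrable_of_integrableOn_Ioo hI1 h0 ha01),
    intervalIntegral.integral_const_mul] at hfin
  exact sub_nonpos.1 hfin

theorem poincareAt_of_const {p l a c s : ℝ} {f u : ℝ → ℝ} {K : NNReal} (hp : 1 < p)
    (ha : a ∈ Ioo (0 : ℝ) 1) (hf : IsUnitWeight f) (hu : LipschitzWith K u)
    (hD : LogDerivGE f a fun _ => c) (hs : 0 < s)
    (hsc : l + (p - 1) * s ^ (p / (p - 1)) ≤ c * s) : PoincareAt p l f u a := by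
  refine poincare_of_riccati (g := fun _ => s) (g' := fun _ => 0) hp ha hf hu
    (fun x => hasDerivAt_const x s) continuous_const (fun _ _ => hs.le) fun x hx d hd => ?_
  have hfx : 0 < f x := hf.pos x ⟨hx.1, hx.2.trans ha.2⟩
  have h1 := mul_le_mul_of_nonneg_left hsc hfx.le
  have h2 := mul_le_mul_of_nonneg_right (hD x hx d hd) hs.le
  linarith

/-- If the Riccati equation with drift `c + κ` up to time `t` and `c` afterwards does not blow up
before time `a`, then the Poincaré inequality holds on `(0, a)`. -/
theorem poincareAt_of_flow {p l a c κ t y Y : ℝ} {f u k D : ℝ → ℝ} {K : NNReal} (hp : 1 < p)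
    (ha : a ∈ Ioo (0 : ℝ) 1) (hf : IsUnitWeight f) (hu : LipschitzWith K u)
    (hD : LogDerivGE f a D) (hDc : ∀ x, c ≤ D x) (hDκ : ∀ x ≤ t, c + κ ≤ D x)
    (hκ : 0 ≤ κ) (hk : Continuous k) (hks : ∀ s, 0 ≤ s → k s ≤ s)
    (hky : ∀ s, y ≤ s → k s = 0) (hy0 : 0 ≤ y) (hyY : y ≤ Y)
    (hB : ∀ s, 0 ≤ s → 0 < l + (p - 1) * s ^ (p / (p - 1)) - c * s - κ * k s)
    (hty : ∫ s in (0 : ℝ)..y, (l + (p - 1) * s ^ (p / (p - 1)) - c * s - κ * k s)⁻¹ ≤ t)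
    (haY : a ≤ ∫ s in (0 : ℝ)..Y, (l + (p - 1) * s ^ (p / (p - 1)) - c * s - κ * k s)⁻¹) :
    PoincareAt p l f u a := by
  have hp1 : 0 < p - 1 := by linarith
  have hq : 0 < p / (p - 1) := by have : 0 < p := by linarith
                                  positivity
  set B : ℝ → ℝ := fun s => l + (p - 1) * s ^ (p / (p - 1)) - c * s - κ * k s with hBdef
  have hBc : Continuous B := by
    have : Continuous fun s : ℝ => s ^ (p / (p - 1)) :=
      Real.continuous_rpow_const hq.le
    fun_prop
  have hY0 : 0 ≤ Y := hy0.trans hyY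
  set r : ℝ → ℝ := fun s => max 0 (min s Y) with hr
  have hrc : Continuous r := by fun_prop
  have hrm : ∀ s, r s ∈ Icc 0 Y := fun s => ⟨le_max_left _ _, max_le hY0 (min_le_right _ _)⟩
  have hrid : ∀ s ∈ Icc 0 Y, r s = s := fun s hs => by
    simp only [hr]
    rw [min_eq_left hs.2, max_eq_right hs.1]
  obtain ⟨s₀, hs₀, hmin⟩ := isCompact_Icc.exists_isMinOn (nonempty_Icc.2 hY0) hBc.continuousOn
  obtain ⟨s₁, hs₁, hmax⟩ := isCompact_Icc.exists_isMaxOn (nonempty_Icc.2 hY0) hBc.continuousOn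
  obtain ⟨g, hg0, hgm, hgd, hgT⟩ := exists_autonomous_flow (B := fun s => B (r s))
    (hBc.comp hrc) (hB s₀ hs₀.1) (fun s => hmin (hrm s)) (M := B s₁) (fun s => hmax (hrm s))
  have hT : ∀ z ∈ Icc 0 Y, g (∫ s in (0 : ℝ)..z, (B s)⁻¹) = z := by
    intro z hz
    rw [← hgT z]
    congr 1
    rw [hgT z]
    apply intervalIntegral.integral_congr
    intro s hs
    rw [uIcc_of_le hz.1] at hs
    simp only [hrid s ⟨hs.1, hs.2.trans hz.2⟩]
  have hgY : g (∫ s in (0 : ℝ)..Y, (B s)⁻¹) = Y := hT Y ⟨hY0, le_rfl⟩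
  have hgy : g (∫ s in (0 : ℝ)..y, (B s)⁻¹) = y := hT y ⟨hy0, hyY⟩
  have hgcont : Continuous g := continuous_iff_continuousAt.2 fun x => (hgd x).continuousAt
  have hgpos : ∀ x ∈ Ioo 0 a, 0 ≤ g x := fun x hx => hg0 ▸ (hgm hx.1).le
  refine poincare_of_riccati (g := g) (g' := fun x => B (r (g x))) hp ha hf hu hgd
    (by fun_prop) hgpos fun x hx d hd => ?_
  have hfx : 0 < f x := hf.pos x ⟨hx.1, hx.2.trans ha.2⟩
  have hgx := hgpos x hx
  have hgxY : g x ≤ Y := by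
    rw [← hgY]
    exact hgm.monotone (hx.2.le.trans haY)
  rw [hrid _ ⟨hgx, hgxY⟩]
  simp only [hBdef]
  suffices h : f x * (c * g x + κ * k (g x)) ≤ d * g x by linarith
  have hdD := mul_le_mul_of_nonneg_right (hD x hx d hd) hgx
  have hfg : 0 ≤ f x * g x := by positivity
  rcases le_or_gt x t with hxt | hxt
  · have h1 := mul_le_mul_of_nonneg_right (hDκ x hxt) hfg
    have h2 := mul_le_mul_of_nonneg_left (hks _ hgx) (by positivity : 0 ≤ f x * κ)
    linarith
  · have hyx : y ≤ g x := by
      rw [← hgy]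
      exact hgm.monotone (hty.trans hxt.le)
    have h1 := mul_le_mul_of_nonneg_right (hDc x) hfg
    rw [hky _ hyx]
    linarith

theorem inv_add_inv_ge {A x t M : ℝ} (hx₁ : 0 < A - x) (hx₂ : 0 < A + x) (ht : 0 ≤ t)
    (htA : 0 < A - x - t) (hM : t = 0 ∨ A - x ≤ M) :
    2 * A⁻¹ + t * (M ^ 2)⁻¹ ≤ (A - x - t)⁻¹ + (A + x)⁻¹ := by
  have hA : 0 < A := by linarith
  have h1 : 2 * A⁻¹ ≤ (A - x)⁻¹ + (A + x)⁻¹ := by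
    rw [← sub_nonneg]
    have : (A - x)⁻¹ + (A + x)⁻¹ - 2 * A⁻¹ = 2 * x ^ 2 / ((A - x) * (A + x) * A) := by
      field_simp
      ring
    rw [this]
    positivity
  have h2 : t * (M ^ 2)⁻¹ ≤ (A - x - t)⁻¹ - (A - x)⁻¹ := by
    have h3 : (A - x - t)⁻¹ - (A - x)⁻¹ = t * ((A - x) * (A - x - t))⁻¹ := by
      field_simp
      ring
    rw [h3]
    rcases hM with rfl | hM
    · simp
    · gcongr
      nlinarith
  linarith

/-- `K₁` is an admissible gain: whenever the logarithmic derivatives of weights on the two sides of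
a point `a` are at least `c` and `-c`, the former exceeding `c` by `κ` on the first quarter, a
Poincaré inequality with any constant below `piP p ^ p + K₁ * κ` holds on one of the sides. -/
def GainConstant (p K₁ : ℝ) : Prop :=
  ∀ κ ∈ Icc (0 : ℝ) 4, ∀ l, piP p ^ p / 2 ≤ l → l < piP p ^ p + K₁ * κ →
      ∀ (a c : ℝ) (f₁ f₂ u₁ u₂ D : ℝ → ℝ) (L₁ L₂ : NNReal), a ∈ Ioo (0 : ℝ) 1 →
        IsUnitWeight f₁ → IsUnitWeight f₂ → LipschitzWith L₁ u₁ → LipschitzWith L₂ u₂ →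
        LogDerivGE f₁ a D → (∀ x, c ≤ D x) → (∀ x ≤ 1 / 4, c + κ ≤ D x) →
        LogDerivGE f₂ (1 - a) (fun _ => -c) →
        PoincareAt p l f₁ u₁ a ∨ PoincareAt p l f₂ u₂ (1 - a)

/-- The drift of the Riccati equation raised by `κ` on an initial time interval of length `1/4`
increases the spectral constant at least linearly in `κ`, uniformly in the constant part of the
drift. -/
theorem exists_gain {p : ℝ} (hp : 1 < p) : ∃ K₁ : ℝ, 0 < K₁ ∧ GainConstant p K₁ := by
  have hp0 : 0 < p := by linarith
  have hp1 : 0 < p - 1 := by linarith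
  have hq : 0 < p / (p - 1) := by positivity
  have hpi := piP_pos hp
  set q := p / (p - 1) with hqdef
  set l₀ := piP p ^ p with hl₀
  have hl₀pos : 0 < l₀ := by positivity
  set C := l₀ + p with hC
  have hCpos : 0 < C := by positivity
  set y := l₀ / (4 * (C + 4)) with hy
  have hypos : 0 < y := by positivity
  set k : ℝ → ℝ := fun s => max 0 (s * (1 - s / y)) with hk
  have hkc : Continuous k := by fun_prop
  have hk0 : ∀ s, 0 ≤ k s := fun s => le_max_left _ _
  have hks : ∀ s, 0 ≤ s → k s ≤ s := fun s hs => by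
    refine max_le hs ?_
    have : 0 ≤ s * (s / y) := by positivity
    linarith
  have hky : ∀ s, y ≤ s → k s = 0 := fun s hs => by
    apply max_eq_left
    have h1 : 1 ≤ s / y := (one_le_div hypos).2 hs
    have h2 : 0 ≤ s := hypos.le.trans hs
    nlinarith
  set k₀ := ∫ s in (0 : ℝ)..y, k s with hk₀
  have hk₀pos : 0 < k₀ := by
    apply intervalIntegral.intervalIntegral_pos_of_pos_on (hkc.intervalIntegrable _ _) _ hypos
    intro s hs
    apply lt_max_of_lt_right
    have : s / y < 1 := (div_lt_one hypos).2 hs.2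
    exact mul_pos hs.1 (by linarith)
  set M := l₀ + 1 + (p - 1) * y ^ q + C * y with hM
  have hMpos : 0 < M := by positivity
  set G := k₀ * (M ^ 2)⁻¹ with hG
  have hGpos : 0 < G := by positivity
  refine ⟨min (1 / 4) (G * l₀), by positivity, ?_⟩
  intro κ hκ l hl hlK a c f₁ f₂ u₁ u₂ D L₁ L₂ ha hf₁ hf₂ hu₁ hu₂ hD₁ hDc hDκ hD₂
  have hlpos : 0 < l := by linarith
  have hl1 : l ≤ l₀ + 1 := by
    have : min (1 / 4) (G * l₀) * κ ≤ 1 / 4 * 4 :=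
      mul_le_mul (min_le_left _ _) hκ.2 hκ.1 (by norm_num)
    linarith
  have hlG : l < l₀ + G * l₀ * κ :=
    hlK.trans_le (by have := mul_le_mul_of_nonneg_right (min_le_right (1 / 4) (G * l₀)) hκ.1
                     linarith)
  have ha' : 1 - a ∈ Ioo (0 : ℝ) 1 := ⟨by linarith [ha.2], by linarith [ha.1]⟩
  by_cases hc₁ : ∃ s, 0 < s ∧ l + (p - 1) * s ^ q ≤ c * s
  · obtain ⟨s, hs, hsc⟩ := hc₁
    exact Or.inl (poincareAt_of_const hp ha hf₁ hu₁
      (fun x hx d hd => (mul_le_mul_of_nonneg_right (hDc x)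
        (hf₁.pos x ⟨hx.1, hx.2.trans ha.2⟩).le).trans (hD₁ x hx d hd)) hs hsc)
  by_cases hc₂ : ∃ s, 0 < s ∧ l + (p - 1) * s ^ q ≤ -c * s
  · obtain ⟨s, hs, hsc⟩ := hc₂
    exact Or.inr (poincareAt_of_const hp ha' hf₂ hu₂ hD₂ hs hsc)
  push Not at hc₁ hc₂
  have hcC : c ≤ C := by
    have := hc₁ 1 one_pos
    rw [Real.one_rpow] at this
    linarith
  have hcC' : -c ≤ C := by
    have := hc₂ 1 one_pos
    rw [Real.one_rpow] at this
    linarith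
  have hrp : ∀ s : ℝ, 0 ≤ s → 0 ≤ (p - 1) * s ^ q := fun s hs => by positivity
  have hA₁ : ∀ s, 0 ≤ s → 0 < l + (p - 1) * s ^ q - c * s := fun s hs => by
    rcases hs.eq_or_lt with rfl | hs
    · simpa [Real.zero_rpow hq.ne'] using hlpos
    · linarith [hc₁ s hs]
  have hA₂ : ∀ s, 0 ≤ s → 0 < l + (p - 1) * s ^ q + c * s := fun s hs => by
    rcases hs.eq_or_lt with rfl | hs
    · simpa [Real.zero_rpow hq.ne'] using hlpos
    · linarith [hc₂ s hs]
  have hyC : (C + 4) * y = l₀ / 4 := by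
    rw [hy]
    field_simp
  have hBlow : ∀ s ∈ Icc 0 y, l₀ / 4 ≤ l + (p - 1) * s ^ q - c * s - κ * k s := by
    intro s hs
    have h1 := mul_le_mul_of_nonneg_left hs.2 (by positivity : 0 ≤ C + 4)
    have h2 := mul_le_mul_of_nonneg_right hcC hs.1
    have h3 : κ * k s ≤ 4 * s := mul_le_mul hκ.2 (hks s hs.1) (hk0 s) (by norm_num)
    have h4 := hrp s hs.1
    linarith
  have hB : ∀ s, 0 ≤ s → 0 < l + (p - 1) * s ^ q - c * s - κ * k s := by
    intro s hs
    rcases le_or_gt s y with hsy | hsy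
    · exact lt_of_lt_of_le (by positivity) (hBlow s ⟨hs, hsy⟩)
    · rw [hky s hsy.le]
      simpa using hA₁ s hs
  have hqc : Continuous fun s : ℝ => s ^ q := Real.continuous_rpow_const hq.le
  have hii : ∀ {F : ℝ → ℝ}, Continuous F → (∀ s, 0 ≤ s → 0 < F s) → ∀ Y, 0 ≤ Y →
      IntervalIntegrable (fun s => (F s)⁻¹) volume 0 Y := by
    intro F hF hpos Y hY
    apply ContinuousOn.intervalIntegrable
    rw [uIcc_of_le hY]
    exact hF.continuousOn.inv₀ fun s hs => (hpos s hs.1).ne'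
  have hI₁ := hii (F := fun s => l + (p - 1) * s ^ q - c * s - κ * k s) (by fun_prop) hB
  have hI₂ := hii (F := fun s => l + (p - 1) * s ^ q + c * s) (by fun_prop) hA₂
  have hI₀ := hii (F := fun s => l + (p - 1) * s ^ q) (by fun_prop)
    fun s hs => by linarith [hrp s hs]
  have hty : ∫ s in (0 : ℝ)..y, (l + (p - 1) * s ^ q - c * s - κ * k s)⁻¹ ≤ 1 / 4 := by
    calc _ ≤ ∫ s in (0 : ℝ)..y, (l₀ / 4)⁻¹ := by
          apply intervalIntegral.integral_mono_on hypos.le (hI₁ y hypos.le) (by simp)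
          intro s hs
          exact inv_anti₀ (by positivity) (hBlow s hs)
      _ = (C + 4)⁻¹ := by
          rw [intervalIntegral.integral_const, ← hyC, smul_eq_mul, sub_zero]
          field_simp
      _ ≤ 1 / 4 := by
          rw [one_div]
          exact inv_anti₀ (by norm_num) (by linarith)
  have hlim : 1 < 2 * (l ^ (-(1 / p)) * (piP p / 2)) + κ * G := by
    have hπ : l₀ ^ (1 / p) = piP p := by
      rw [hl₀, ← Real.rpow_mul hpi.le, mul_one_div_cancel hp0.ne', Real.rpow_one]
    have h1 : 2 * (l ^ (-(1 / p)) * (piP p / 2)) = (l₀ / l) ^ (1 / p) := by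
      rw [Real.div_rpow hl₀pos.le hlpos.le, hπ, Real.rpow_neg hlpos.le]
      ring
    rw [h1]
    rcases lt_or_ge l l₀ with hll | hll
    · have : 1 < (l₀ / l) ^ (1 / p) :=
        Real.one_lt_rpow ((one_lt_div hlpos).2 hll) (by positivity)
      have : 0 ≤ κ * G := mul_nonneg hκ.1 hGpos.le
      linarith
    · have h2 : l₀ / l ≤ (l₀ / l) ^ (1 / p) :=
        Real.self_le_rpow_of_le_one (by positivity) ((div_le_one hlpos).2 hll)
          ((div_le_one hp0).2 hp.le)
      have h3 : 1 - κ * G < l₀ / l := by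
        rw [lt_div_iff₀ hlpos]
        have : 0 ≤ κ * G * (l - l₀) :=
          mul_nonneg (mul_nonneg hκ.1 hGpos.le) (sub_nonneg.2 hll)
        linarith
      linarith
  obtain ⟨Y, hY, hyY⟩ := ((((tendsto_integral_inv_add_rpow hp hlpos).const_mul 2).add_const
    (κ * G)).eventually (lt_mem_nhds hlim)).and (eventually_ge_atTop y) |>.exists
  have hY0 : 0 ≤ Y := hypos.le.trans hyY
  have hkY : k₀ ≤ ∫ s in (0 : ℝ)..Y, k s := by
    rw [← intervalIntegral.integral_add_adjacent_intervals (hkc.intervalIntegrable 0 y)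
      (hkc.intervalIntegrable y Y)]
    have := intervalIntegral.integral_nonneg (μ := volume) hyY fun s _ => hk0 s
    linarith
  have hsum : 2 * (∫ s in (0 : ℝ)..Y, (l + (p - 1) * s ^ q)⁻¹) + κ * G ≤
      (∫ s in (0 : ℝ)..Y, (l + (p - 1) * s ^ q - c * s - κ * k s)⁻¹) +
        ∫ s in (0 : ℝ)..Y, (l + (p - 1) * s ^ q + c * s)⁻¹ := by
    calc _ ≤ 2 * (∫ s in (0 : ℝ)..Y, (l + (p - 1) * s ^ q)⁻¹)
            + (κ * (M ^ 2)⁻¹) * ∫ s in (0 : ℝ)..Y, k s := by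
          have := mul_le_mul_of_nonneg_left hkY
            (mul_nonneg hκ.1 (by positivity : 0 ≤ (M ^ 2)⁻¹))
          rw [hG]
          linarith
      _ = ∫ s in (0 : ℝ)..Y, (2 * (l + (p - 1) * s ^ q)⁻¹ + (κ * (M ^ 2)⁻¹) * k s) := by
          rw [intervalIntegral.integral_add ((hI₀ Y hY0).const_mul 2)
            ((hkc.intervalIntegrable _ _).const_mul _), intervalIntegral.integral_const_mul,
            intervalIntegral.integral_const_mul]
      _ ≤ ∫ s in (0 : ℝ)..Y, ((l + (p - 1) * s ^ q - c * s - κ * k s)⁻¹ +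
            (l + (p - 1) * s ^ q + c * s)⁻¹) := by
          apply intervalIntegral.integral_mono_on hY0
            (((hI₀ Y hY0).const_mul 2).add ((hkc.intervalIntegrable _ _).const_mul _))
            ((hI₁ Y hY0).add (hI₂ Y hY0))
          intro s hs
          have h := inv_add_inv_ge (M := M) (hA₁ s hs.1) (hA₂ s hs.1)
            (mul_nonneg hκ.1 (hk0 s)) (hB s hs.1) (by
              rcases le_or_gt y s with hys | hys
              · left
                rw [hky s hys, mul_zero]
              · right
                have h1 : s ^ q ≤ y ^ q := Real.rpow_le_rpow hs.1 hys.le hq.le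
                have h2 := mul_le_mul_of_nonneg_left h1 hp1.le
                have h3 : -c * s ≤ C * y := mul_le_mul hcC' hys.le hs.1 hCpos.le
                linarith)
          linarith
      _ = _ := intervalIntegral.integral_add (hI₁ Y hY0) (hI₂ Y hY0)
  rcases le_total a (∫ s in (0 : ℝ)..Y, (l + (p - 1) * s ^ q - c * s - κ * k s)⁻¹) with haY | haY
  · exact Or.inl (poincareAt_of_flow hp ha hf₁ hu₁ hD₁ hDc hDκ hκ.1 hkc hks hky hypos.le hyY hB
      hty haY)
  · right
    refine poincareAt_of_flow (κ := 0) (t := 0) (y := 0) (Y := Y) (c := -c) (k := fun _ => 0) hp ha'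
      hf₂ hu₂ hD₂ (fun _ => le_rfl) (by simp) le_rfl continuous_const (fun s hs => hs)
      (fun _ _ => rfl) le_rfl hY0 (fun s hs => by have := hA₂ s hs; linarith) (by simp) ?_
    have : ∀ s : ℝ, l + (p - 1) * s ^ q - -c * s - 0 * 0 = l + (p - 1) * s ^ q + c * s := by
      intro s; ring
    simp_rw [← hqdef, this]
    linarith

theorem ConcaveOn.log_of_pos {s : Set ℝ} {f : ℝ → ℝ} (hf : ConcaveOn ℝ s f)
    (hpos : ∀ x ∈ s, 0 < f x) : ConcaveOn ℝ s fun x => Real.log (f x) := by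
  refine ⟨hf.1, fun x hx y hy a b ha hb hab => ?_⟩
  have h1 := strictConcaveOn_log_Ioi.concaveOn.2 (hpos x hx) (hpos y hy) ha hb hab
  refine h1.trans (Real.log_le_log ?_ (hf.2 hx hy ha hb hab))
  exact (convex_Ioi (0 : ℝ)) (hpos x hx) (hpos y hy) ha hb hab

theorem LocallyLipschitz.comp_locallyLipschitzOn_eqOn {s : Set ℝ} {F g f : ℝ → ℝ}
    (hF : LocallyLipschitz F) (hg : LocallyLipschitzOn s g) (hfg : ∀ x ∈ s, f x = F (g x)) :
    LocallyLipschitzOn s f := by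
  intro x hx
  obtain ⟨K, t, ht, hK⟩ := hg hx
  obtain ⟨K', t', ht', hK'⟩ := hF (g x)
  refine ⟨K' * K, (t ∩ g ⁻¹' t') ∩ s, inter_mem (inter_mem ht
    (hg.continuousOn x hx ht')) self_mem_nhdsWithin, ?_⟩
  intro y hy z hz
  rw [hfg y hy.2, hfg z hz.2]
  exact (hK'.comp (hK.mono inter_subset_left) fun w hw => hw.2) hy.1 hz.1

theorem ConcaveOn.exists_superslope {ψ : ℝ → ℝ} {s : Set ℝ} (hψ : ConcaveOn ℝ s ψ)
    {a : ℝ} (ha : a ∈ interior s) :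
    ∃ e, (∀ x ∈ s, x < a → ∀ d, HasDerivAt ψ d x → e ≤ d) ∧
      ∀ x ∈ s, a < x → ∀ d, HasDerivAt ψ d x → d ≤ e := by
  have hr := hψ.neg.hasDerivWithinAt_rightDeriv_of_mem_interior ha
  have hl := hψ.neg.hasDerivWithinAt_leftDeriv_of_mem_interior ha
  have hlr := hψ.neg.leftDeriv_le_rightDeriv_of_mem_interior ha
  have has := interior_subset ha
  refine ⟨-derivWithin (-ψ) (Ioi a) a, fun x hx hxa d hd => ?_, fun x hx hxa d hd => ?_⟩
  · have h1 := hψ.neg.le_slope_of_hasDerivAt hx has hxa hd.neg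
    have h2 := hψ.neg.slope_le_of_hasDerivWithinAt_Iio hx has hxa hl
    linarith
  · have h1 := hψ.neg.slope_le_of_hasDerivAt has hx hxa hd.neg
    have h2 := hψ.neg.le_slope_of_hasDerivWithinAt_Ioi has hx hxa hr
    linarith

/-- A concave differentiable `h` and a log-concave `φ`, both positive on `(0, 1)`, whose product is
at most `1`. -/
structure IsWeightPair (h φ : ℝ → ℝ) : Prop where
  left_pos : ∀ x ∈ Ioo (0 : ℝ) 1, 0 < h x
  concaveOn : ConcaveOn ℝ (Ioo (0 : ℝ) 1) h
  differentiableOn : DifferentiableOn ℝ h (Ioo (0 : ℝ) 1)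
  right_pos : ∀ x ∈ Ioo (0 : ℝ) 1, 0 < φ x
  concaveOn_log : ConcaveOn ℝ (Ioo (0 : ℝ) 1) fun x => Real.log (φ x)
  le_one : ∀ x ∈ Ioo (0 : ℝ) 1, h x * φ x ≤ 1

theorem one_sub_mem_Ioo {x : ℝ} (hx : x ∈ Ioo (0 : ℝ) 1) : 1 - x ∈ Ioo (0 : ℝ) 1 :=
  ⟨by linarith [hx.2], by linarith [hx.1]⟩

theorem ConcaveOn.comp_one_sub {f : ℝ → ℝ} (hf : ConcaveOn ℝ (Ioo (0 : ℝ) 1) f) :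
    ConcaveOn ℝ (Ioo (0 : ℝ) 1) fun x => f (1 - x) := by
  refine ⟨hf.1, fun x hx y hy a b ha hb hab => ?_⟩
  have h1 := hf.2 (one_sub_mem_Ioo hx) (one_sub_mem_Ioo hy) ha hb hab
  have h2 : 1 - (a • x + b • y) = a • (1 - x) + b • (1 - y) := by
    simp only [smul_eq_mul]
    linear_combination -hab
  simp only [h2]
  exact h1

namespace IsWeightPair

variable {h φ : ℝ → ℝ}

theorem reflect (H : IsWeightPair h φ) :
    IsWeightPair (fun x => h (1 - x)) (fun x => φ (1 - x)) where
  left_pos x hx := H.left_pos _ (one_sub_mem_Ioo hx)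
  concaveOn := H.concaveOn.comp_one_sub
  differentiableOn := H.differentiableOn.comp (by fun_prop) fun x hx => one_sub_mem_Ioo hx
  right_pos x hx := H.right_pos _ (one_sub_mem_Ioo hx)
  concaveOn_log := H.concaveOn_log.comp_one_sub
  le_one x hx := H.le_one _ (one_sub_mem_Ioo hx)

theorem isUnitWeight (H : IsWeightPair h φ) : IsUnitWeight fun x => h x * φ x where
  pos x hx := mul_pos (H.left_pos x hx) (H.right_pos x hx)
  le_one := H.le_one
  locallyLipschitzOn := by
    have h1 := (H.concaveOn.log_of_pos H.left_pos).add H.concaveOn_log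
    apply (Real.contDiff_exp (n := 1)).locallyLipschitz.comp_locallyLipschitzOn_eqOn
      (h1.locallyLipschitzOn isOpen_Ioo)
    intro x hx
    have h2 := H.left_pos x hx
    have h3 := H.right_pos x hx
    simp only [Pi.add_apply]
    rw [Real.exp_add, Real.exp_log h2, Real.exp_log h3]

theorem hasDerivAt_left (H : IsWeightPair h φ) {x : ℝ} (hx : x ∈ Ioo (0 : ℝ) 1) :
    HasDerivAt h (deriv h x) x :=
  (H.differentiableOn.differentiableAt (isOpen_Ioo.mem_nhds hx)).hasDerivAt

theorem hasDerivAt_log_left (H : IsWeightPair h φ) {x : ℝ} (hx : x ∈ Ioo (0 : ℝ) 1) :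
    HasDerivAt (fun x => Real.log (h x)) (deriv h x / h x) x :=
  (H.hasDerivAt_left hx).log (H.left_pos x hx).ne'

theorem logDeriv_left_antitoneOn (H : IsWeightPair h φ) :
    AntitoneOn (fun x => deriv h x / h x) (Ioo 0 1) := by
  intro x hx y hy hxy
  have := (H.concaveOn.log_of_pos H.left_pos).antitoneOn_deriv
    (fun z hz => (H.hasDerivAt_log_left hz).differentiableAt) hx hy hxy
  rwa [(H.hasDerivAt_log_left hx).deriv, (H.hasDerivAt_log_left hy).deriv] at this

theorem exists_hasDerivAt_log_right (H : IsWeightPair h φ) {x d : ℝ} (hx : x ∈ Ioo (0 : ℝ) 1)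
    (hd : HasDerivAt (fun x => h x * φ x) d x) :
    ∃ d', HasDerivAt (fun x => Real.log (φ x)) d' x ∧
      d = (deriv h x / h x + d') * (h x * φ x) := by
  have hh := H.left_pos x hx
  have hφ := H.right_pos x hx
  have h1 : HasDerivAt (fun x => Real.log (h x * φ x)) (d / (h x * φ x)) x :=
    hd.log (mul_pos hh hφ).ne'
  refine ⟨d / (h x * φ x) - deriv h x / h x, ?_, ?_⟩
  · refine (h1.sub (H.hasDerivAt_log_left hx)).congr_of_eventuallyEq ?_
    filter_upwards [isOpen_Ioo.mem_nhds hx] with z hz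
    simp only [Pi.sub_apply]
    rw [Real.log_mul (H.left_pos z hz).ne' (H.right_pos z hz).ne']
    ring
  · field_simp
    ring

theorem secant_bounds (H : IsWeightPair h φ) {x y : ℝ} (hx : x ∈ Ioo (0 : ℝ) 1)
    (hy : y ∈ Ioo (0 : ℝ) 1) (hxy : x < y) :
    deriv h y * (y - x) ≤ h y - h x ∧ h y - h x ≤ deriv h x * (y - x) := by
  have h1 := H.concaveOn.le_slope_of_hasDerivAt hx hy hxy (H.hasDerivAt_left hy)
  have h2 := H.concaveOn.slope_le_of_hasDerivAt hx hy hxy (H.hasDerivAt_left hx)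
  rw [slope_def_field] at h1 h2
  have h3 : 0 < y - x := sub_pos.2 hxy
  exact ⟨(le_div_iff₀ h3).1 h1, (div_le_iff₀ h3).1 h2⟩

theorem logDeriv_left_half_sq_le (H : IsWeightPair h φ) :
    (deriv h (1 / 2) / h (1 / 2)) ^ 2 ≤ 16 := by
  have m1 : (1 / 4 : ℝ) ∈ Ioo (0 : ℝ) 1 := by norm_num
  have m2 : (1 / 2 : ℝ) ∈ Ioo (0 : ℝ) 1 := by norm_num
  have m3 : (3 / 4 : ℝ) ∈ Ioo (0 : ℝ) 1 := by norm_num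
  have h1 := H.left_pos _ m1
  have h2 := H.left_pos _ m2
  have h3 := H.left_pos _ m3
  have s1 := (H.secant_bounds m1 m2 (by norm_num)).1
  have s2 := (H.secant_bounds m2 m3 (by norm_num)).2
  have b1 : deriv h (1 / 2) / h (1 / 2) ≤ 4 := by
    rw [div_le_iff₀ h2]
    linarith
  have b2 : -4 ≤ deriv h (1 / 2) / h (1 / 2) := by
    rw [le_div_iff₀ h2]
    linarith
  nlinarith

theorem logDeriv_left_gain (H : IsWeightPair h φ) {κ : ℝ} (hκ : κ ∈ Icc (0 : ℝ) 4)
    (hquarter : 4 * κ ≤ (deriv h (1 / 4) / h (1 / 4)) ^ 2)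
    (hhalf : 4 * κ ≤ (deriv h (1 / 2) / h (1 / 2)) ^ 2) :
    deriv h (1 / 2) / h (1 / 2) + κ ≤ deriv h (1 / 4) / h (1 / 4) := by
  have m1 : (1 / 4 : ℝ) ∈ Ioo (0 : ℝ) 1 := by norm_num
  have m2 : (1 / 2 : ℝ) ∈ Ioo (0 : ℝ) 1 := by norm_num
  have h1 := H.left_pos _ m1
  have h2 := H.left_pos _ m2
  obtain ⟨s1, s2⟩ := H.secant_bounds m1 m2 (by norm_num)
  set r := deriv h (1 / 2) / h (1 / 2) with hr
  set s := deriv h (1 / 4) / h (1 / 4) with hs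
  have er : deriv h (1 / 2) = r * h (1 / 2) := by rw [hr]; field_simp
  have es : deriv h (1 / 4) = s * h (1 / 4) := by rw [hs]; field_simp
  rw [er] at s1
  rw [es] at s2
  rcases le_or_gt 0 r with hr0 | hr0
  · have h3 : r * h (1 / 2) ≤ s * h (1 / 4) := by linarith
    have h4 : h (1 / 4) ≤ h (1 / 2) * (1 - r / 4) := by linarith
    have h5 : (r + r ^ 2 / 4) * h (1 / 4) ≤ s * h (1 / 4) := by
      have h6 := mul_le_mul_of_nonneg_left h4 (by positivity : 0 ≤ r + r ^ 2 / 4)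
      have h7 : 0 ≤ r ^ 3 * h (1 / 2) := by positivity
      linarith
    have := le_of_mul_le_mul_right h5 h1
    linarith
  · rcases le_or_gt 0 s with hs0 | hs0
    · have h3 : κ ^ 2 ≤ (s - r) ^ 2 := by nlinarith [hκ.1, hκ.2, mul_nonneg hs0 (neg_pos.2 hr0).le]
      have := abs_le_of_sq_le_sq h3 (by linarith)
      linarith [le_abs_self κ]
    · have h3 : r * h (1 / 2) ≤ s * h (1 / 4) := by linarith
      have h4 : h (1 / 2) ≤ h (1 / 4) * (1 + s / 4) := by linarith
      have h5 : r * h (1 / 2) ≤ (s - s ^ 2 / 4) * h (1 / 2) := by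
        have h6 := mul_le_mul_of_nonneg_left h4 (by nlinarith : 0 ≤ -(s - s ^ 2 / 4))
        have h7 : 0 ≤ (-s) ^ 3 * h (1 / 4) := by
          have : 0 < -s := by linarith
          positivity
        linarith
      have := le_of_mul_le_mul_right h5 h2
      linarith

end IsWeightPair

theorem LipschitzWith.comp_one_sub {u : ℝ → ℝ} {L : NNReal} (hu : LipschitzWith L u) :
    LipschitzWith L fun x => u (1 - x) := by
  refine LipschitzWith.of_dist_le_mul fun x y => ?_
  simpa only [dist_sub_left] using hu.dist_le_mul (1 - x) (1 - y)

theorem IsWeightPair.poincareAt_or_of_half_le {p K₁ κ l a : ℝ} {h φ u : ℝ → ℝ} {L : NNReal}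
    (H : IsWeightPair h φ) (hK : GainConstant p K₁) (hκ : κ ∈ Icc (0 : ℝ) 4)
    (hκh : ∀ x ∈ Icc (1 / 4 : ℝ) (3 / 4), 4 * κ ≤ (deriv h x / h x) ^ 2)
    (hl : piP p ^ p / 2 ≤ l) (hlK : l < piP p ^ p + K₁ * κ) (hu : LipschitzWith L u)
    (ha : a ∈ Ioo (0 : ℝ) 1) (ha2 : 1 / 2 ≤ a) :
    PoincareAt p l (fun x => h x * φ x) u a ∨
      PoincareAt p l (fun x => h (1 - x) * φ (1 - x)) (fun x => u (1 - x)) (1 - a) := by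
  obtain ⟨e, he1, he2⟩ := H.concaveOn_log.exists_superslope (by rwa [isOpen_Ioo.interior_eq])
  have hgain := H.logDeriv_left_gain hκ (hκh _ (by norm_num)) (hκh _ (by norm_num))
  have hanti := H.logDeriv_left_antitoneOn
  have m1 : (1 / 4 : ℝ) ∈ Ioo (0 : ℝ) 1 := by norm_num
  have m2 : (1 / 2 : ℝ) ∈ Ioo (0 : ℝ) 1 := by norm_num
  set c := deriv h a / h a + e with hc
  refine hK κ hκ l hl hlK a c _ _ _ _ (fun x => if x ≤ 1 / 4 then c + κ else c) L L ha
    H.isUnitWeight H.reflect.isUnitWeight hu hu.comp_one_sub ?_ ?_ ?_ ?_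
  · intro x hx d hd
    have hx1 : x ∈ Ioo (0 : ℝ) 1 := ⟨hx.1, hx.2.trans ha.2⟩
    obtain ⟨d', hd', rfl⟩ := H.exists_hasDerivAt_log_right hx1 hd
    refine mul_le_mul_of_nonneg_right ?_ (H.isUnitWeight.pos x hx1).le
    have h1 := he1 x hx1 hx.2 d' hd'
    dsimp only
    split_ifs with hx4
    · have h2 : deriv h (1 / 4) / h (1 / 4) ≤ deriv h x / h x := hanti hx1 m1 hx4
      have h3 : deriv h a / h a ≤ deriv h (1 / 2) / h (1 / 2) := hanti m2 ha ha2
      linarith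
    · have h2 : deriv h a / h a ≤ deriv h x / h x := hanti hx1 ha hx.2.le
      linarith
  · intro x
    split_ifs <;> linarith [hκ.1]
  · intro x hx
    rw [if_pos hx]
  · intro x hx d hd
    have hx1 : 1 - x ∈ Ioo (0 : ℝ) 1 := ⟨by linarith [hx.2, ha.1], by linarith [hx.1]⟩
    have hax : a < 1 - x := by linarith [hx.2]
    have hd2 : HasDerivAt (fun z => h z * φ z) (-d) (1 - x) := by
      have e1 : (1 - (1 - x)) = x := by ring
      rw [← e1] at hd
      have := HasDerivAt.comp_const_sub 1 (1 - x) hd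
      simpa using this
    obtain ⟨d', hd', hdd⟩ := H.exists_hasDerivAt_log_right hx1 hd2
    have h1 := he2 _ hx1 hax d' hd'
    have h2 : deriv h (1 - x) / h (1 - x) ≤ deriv h a / h a := hanti ha hx1 hax.le
    have h3 := mul_le_mul_of_nonneg_right (add_le_add h2 h1) (H.isUnitWeight.pos _ hx1).le
    dsimp only at h3 ⊢
    linarith

theorem IsWeightPair.poincareAt_or {p K₁ κ l a : ℝ} {h φ u : ℝ → ℝ} {L : NNReal}
    (H : IsWeightPair h φ) (hK : GainConstant p K₁) (hκ : κ ∈ Icc (0 : ℝ) 4)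
    (hκh : ∀ x ∈ Icc (1 / 4 : ℝ) (3 / 4), 4 * κ ≤ (deriv h x / h x) ^ 2)
    (hl : piP p ^ p / 2 ≤ l) (hlK : l < piP p ^ p + K₁ * κ) (hu : LipschitzWith L u)
    (ha : a ∈ Ioo (0 : ℝ) 1) :
    PoincareAt p l (fun x => h x * φ x) u a ∨
      PoincareAt p l (fun x => h (1 - x) * φ (1 - x)) (fun x => u (1 - x)) (1 - a) := by
  rcases le_total (1 / 2) a with ha2 | ha2
  · exact H.poincareAt_or_of_half_le hK hκ hκh hl hlK hu ha ha2
  · have h1 := H.reflect.poincareAt_or_of_half_le hK hκ (fun x hx => ?_) hl hlK hu.comp_one_sub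
      (one_sub_mem_Ioo ha) (by linarith)
    · simp only [sub_sub_cancel] at h1
      exact h1.symm
    · have h2 := hκh (1 - x) ⟨by linarith [hx.2], by linarith [hx.1]⟩
      rwa [deriv_comp_const_sub, neg_div, neg_sq]

theorem poincareAt_one_sub_iff {p l a : ℝ} {f u : ℝ → ℝ} :
    PoincareAt p l (fun x => f (1 - x)) (fun x => u (1 - x)) (1 - a) ↔
      l * ∫ x in a..1, f x * |u x - u a| ^ p ≤ ∫ x in a..1, f x * |deriv u x| ^ p := by
  have h1 := intervalIntegral.integral_comp_sub_left (a := 0) (b := 1 - a)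
    (fun x => f x * |u x - u a| ^ p) 1
  have h2 := intervalIntegral.integral_comp_sub_left (a := 0) (b := 1 - a)
    (fun x => f x * |deriv u x| ^ p) 1
  simp only [sub_sub_cancel, sub_zero] at h1 h2
  simp only [PoincareAt, sub_sub_cancel, deriv_comp_const_sub, abs_neg, h1, h2]

theorem isClosed_setOf_poincareAt {p l : ℝ} {f u : ℝ → ℝ} {K : NNReal} (hp : 1 < p)
    (hf : IsUnitWeight f) (hu : LipschitzWith K u) :
    IsClosed {a | a ∈ Icc (0 : ℝ) 1 ∧ PoincareAt p l f u a} := by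
  have hp0 : 0 < p := by linarith
  have hintegrable := integrableOn_weight_mul_deriv hp hf hu
  have hr : ContinuousOn (fun a => ∫ x in (0 : ℝ)..a, f x * |deriv u x| ^ p) (Icc 0 1) := by
    have := intervalIntegral.continuousOn_primitive_interval (μ := volume)
      (a := 0) (b := 1) (f := fun x => f x * |deriv u x| ^ p) (by
        rw [uIcc_of_le zero_le_one, integrableOn_Icc_iff_integrableOn_Ioo]
        exact hintegrable)
    rwa [uIcc_of_le zero_le_one] at this
  have hcut : ∀ a ∈ Icc (0 : ℝ) 1, ∫ x in (0 : ℝ)..a, f x * |u x - u a| ^ p =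
      ∫ x in Ioo (0 : ℝ) 1, f x * |u (min x a) - u a| ^ p := by
    intro a ha
    have hI := integrableOn_weight_mul_continuous hf (continuous_abs_rpow hp
      (v := fun x => u (min x a) - u a)
      ((hu.continuous.comp (continuous_id.min continuous_const)).sub continuous_const))
    rw [← integral_Ioc_eq_integral_Ioo, ← intervalIntegral.integral_of_le zero_le_one,
      ← intervalIntegral.integral_add_adjacent_intervals
        (intervalIntegrable_of_integrableOn_Ioo hI (by simp) ha)
        (intervalIntegrable_of_integrableOn_Ioo hI ha (by simp))]
    have h2 : ∫ x in a..1, f x * |u (min x a) - u a| ^ p = 0 := by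
      apply intervalIntegral.integral_zero_ae
      refine Eventually.of_forall fun x hx => ?_
      rw [uIoc_of_le ha.2] at hx
      rw [min_eq_right hx.1.le]
      simp [Real.zero_rpow hp0.ne']
    rw [h2, add_zero]
    apply intervalIntegral.integral_congr_ae
    refine Eventually.of_forall fun x hx => ?_
    rw [uIoc_of_le ha.1] at hx
    simp only [min_eq_left hx.2]
  have hl : ContinuousOn (fun a => ∫ x in (0 : ℝ)..a, f x * |u x - u a| ^ p) (Icc 0 1) := by
    refine ContinuousOn.congr ?_ hcut
    apply continuousOn_of_dominated (bound := fun _ => (K : ℝ) ^ p)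
    · intro a ha
      exact (integrableOn_weight_mul_continuous hf (continuous_abs_rpow hp
        (v := fun x => u (min x a) - u a)
        ((hu.continuous.comp (continuous_id.min continuous_const)).sub
          continuous_const))).aestronglyMeasurable
    · intro a ha
      filter_upwards [self_mem_ae_restrict measurableSet_Ioo] with x hx
      have h1 : |u (min x a) - u a| ≤ K := by
        have h2 := hu.dist_le_mul (min x a) a
        rw [Real.dist_eq, Real.dist_eq] at h2
        refine h2.trans (mul_le_of_le_one_right K.2 ?_)
        rw [abs_le]
        constructor
        · rcases min_choice x a with h3 | h3 <;> rw [h3] <;> linarith [hx.1, ha.2]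
        · linarith [min_le_right x a]
      rw [Real.norm_eq_abs, abs_of_nonneg (mul_nonneg (hf.pos x hx).le (by positivity))]
      calc f x * |u (min x a) - u a| ^ p ≤ 1 * (K : ℝ) ^ p := by
            gcongr
            exact hf.le_one x hx
        _ = K ^ p := one_mul _
    · exact integrableOn_const (by simp)
    · refine Eventually.of_forall fun x => Continuous.continuousOn ?_
      refine continuous_const.mul (continuous_abs_rpow hp ?_)
      exact (hu.continuous.comp (continuous_const.min continuous_id)).sub hu.continuous
  exact isClosed_Icc.isClosed_le (continuousOn_const.mul hl) hr

theorem IsWeightPair.exists_poincare_sub {p K₁ κ l : ℝ} {h φ u : ℝ → ℝ} {L : NNReal} (hp : 1 < p)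
    (H : IsWeightPair h φ) (hK : GainConstant p K₁) (hκ : κ ∈ Icc (0 : ℝ) 4)
    (hκh : ∀ x ∈ Icc (1 / 4 : ℝ) (3 / 4), 4 * κ ≤ (deriv h x / h x) ^ 2)
    (hl : piP p ^ p / 2 ≤ l) (hlK : l < piP p ^ p + K₁ * κ) (hu : LipschitzWith L u) :
    ∃ c, l * ∫ x in Ioo (0 : ℝ) 1, h x * φ x * |u x - c| ^ p ≤
      ∫ x in Ioo (0 : ℝ) 1, h x * φ x * |deriv u x| ^ p := by
  have hf := H.isUnitWeight
  have hA := isClosed_setOf_poincareAt (l := l) hp hf hu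
  have hB := (isClosed_setOf_poincareAt (l := l) hp H.reflect.isUnitWeight
    hu.comp_one_sub).preimage (continuous_sub_left (1 : ℝ))
  have h0 : PoincareAt p l (fun x => h x * φ x) u 0 := by simp [PoincareAt]
  have h1 : PoincareAt p l (fun x => h (1 - x) * φ (1 - x)) (fun x => u (1 - x)) (1 - 1) := by
    simp [PoincareAt]
  have hcover : Icc (0 : ℝ) 1 ⊆ {a | a ∈ Icc (0 : ℝ) 1 ∧ PoincareAt p l (fun x => h x * φ x) u a} ∪
      (fun a : ℝ => 1 - a) ⁻¹' {a | a ∈ Icc (0 : ℝ) 1 ∧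
        PoincareAt p l (fun x => h (1 - x) * φ (1 - x)) (fun x => u (1 - x)) a} := by
    intro a ha
    rcases eq_or_lt_of_le ha.1 with rfl | ha0
    · exact Or.inl ⟨ha, h0⟩
    rcases eq_or_lt_of_le ha.2 with rfl | ha1
    · exact Or.inr ⟨by simp, h1⟩
    rcases H.poincareAt_or hK hκ hκh hl hlK hu ⟨ha0, ha1⟩ with h2 | h2
    · exact Or.inl ⟨ha, h2⟩
    · exact Or.inr ⟨⟨by linarith, by linarith⟩, h2⟩
  obtain ⟨a, ha, haA, haB⟩ := isPreconnected_closed_iff.1 isPreconnected_Icc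
    _ _ hA hB hcover ⟨0, by simp, by simp, h0⟩ ⟨1, by simp, by simp, h1⟩
  have hB' := (poincareAt_one_sub_iff (f := fun x => h x * φ x)).1 haB.2
  have hA' := haA.2
  have hI1 := integrableOn_weight_mul_deriv hp hf hu
  have hI2 := integrableOn_weight_mul_continuous hf (continuous_abs_rpow hp
    (v := fun x => u x - u a) (hu.continuous.sub continuous_const))
  refine ⟨u a, ?_⟩
  rw [PoincareAt] at hA'
  simp only [← integral_Ioc_eq_integral_Ioo, ← intervalIntegral.integral_of_le zero_le_one]
  rw [← intervalIntegral.integral_add_adjacent_intervals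
      (intervalIntegrable_of_integrableOn_Ioo hI1 (by simp) ha)
      (intervalIntegrable_of_integrableOn_Ioo hI1 ha (by simp)),
    ← intervalIntegral.integral_add_adjacent_intervals
      (intervalIntegrable_of_integrableOn_Ioo hI2 (by simp) ha)
      (intervalIntegrable_of_integrableOn_Ioo hI2 ha (by simp)), mul_add]
  exact add_le_add hA' hB'

theorem integral_abs_rpow_le_integral_abs_sub_rpow {p : ℝ} {f u : ℝ → ℝ} (hp : 1 < p)
    (hf : IsUnitWeight f) (hu : Continuous u)
    (hmean : ∫ x in Ioo (0 : ℝ) 1, f x * |u x| ^ (p - 2) * u x = 0) (c : ℝ) :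
    ∫ x in Ioo (0 : ℝ) 1, f x * |u x| ^ p ≤ ∫ x in Ioo (0 : ℝ) 1, f x * |u x - c| ^ p := by
  have hI1 := integrableOn_weight_mul_continuous hf (continuous_abs_rpow hp hu)
  have hI2 := integrableOn_weight_mul_continuous hf (continuous_abs_rpow hp
    (v := fun x => u x - c) (hu.sub continuous_const))
  have hI3 : IntegrableOn (fun x => p * c * (f x * |u x| ^ (p - 2) * u x)) (Ioo 0 1) := by
    have := integrableOn_weight_mul_continuous hf ((continuous_abs_rpow_sub_two_mul hp).comp hu)
    simp only [mul_assoc (f _)]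
    exact this.const_mul (p * c)
  calc ∫ x in Ioo (0 : ℝ) 1, f x * |u x| ^ p
      = ∫ x in Ioo (0 : ℝ) 1, (f x * |u x| ^ p - p * c * (f x * |u x| ^ (p - 2) * u x)) := by
        rw [integral_sub hI1 hI3, integral_const_mul, hmean, mul_zero, sub_zero]
    _ ≤ _ := by
        refine setIntegral_mono_on (hI1.sub hI3) hI2 measurableSet_Ioo fun x hx => ?_
        have := mul_le_mul_of_nonneg_left (abs_rpow_tangent_le hp (u x) c) (hf.pos x hx).le
        linarith

theorem integral_weight_mul_abs_rpow_pos {p : ℝ} {f u : ℝ → ℝ} (hp : 1 < p)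
    (hf : IsUnitWeight f) (hu : Continuous u)
    (hne : ¬ ∀ᵐ x ∂volume.restrict (Ioo (0 : ℝ) 1), u x = 0) :
    0 < ∫ x in Ioo (0 : ℝ) 1, f x * |u x| ^ p := by
  have hI := integrableOn_weight_mul_continuous hf (continuous_abs_rpow hp hu)
  have h0 : 0 ≤ᵐ[volume.restrict (Ioo (0 : ℝ) 1)] fun x => f x * |u x| ^ p := by
    filter_upwards [self_mem_ae_restrict measurableSet_Ioo] with x hx
    exact mul_nonneg (hf.pos x hx).le (by positivity)
  refine lt_of_le_of_ne (integral_nonneg_of_ae h0) fun heq => hne ?_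
  filter_upwards [(integral_eq_zero_iff_of_nonneg_ae h0 hI).1 heq.symm,
    self_mem_ae_restrict measurableSet_Ioo] with x hx hx1
  have h1 := (mul_eq_zero.1 hx).resolve_left (hf.pos x hx1).ne'
  exact abs_eq_zero.1 ((Real.rpow_eq_zero (abs_nonneg _) (by linarith)).1 h1)

theorem exists_integral_abs_sub_rpow_mul_eq_zero {p : ℝ} {f : ℝ → ℝ} (hp : 1 < p)
    (hf : IsUnitWeight f) :
    ∃ t : ℝ, ∫ x in Ioo (0 : ℝ) 1, f x * |x - t| ^ (p - 2) * (x - t) = 0 := by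
  have hψ := continuous_abs_rpow_sub_two_mul hp
  have hc : ContinuousOn (fun t : ℝ => ∫ x in Ioo (0 : ℝ) 1, f x * |x - t| ^ (p - 2) * (x - t))
      (Icc 0 1) := by
    simp only [mul_assoc]
    obtain ⟨C, hC⟩ := isCompact_Icc.exists_bound_of_continuousOn
      (s := Icc (-1 : ℝ) 1) hψ.continuousOn
    apply continuousOn_of_dominated (bound := fun _ => C)
    · intro t _
      exact (integrableOn_weight_mul_continuous hf
        (hψ.comp (continuous_id.sub continuous_const))).aestronglyMeasurable
    · intro t ht
      filter_upwards [self_mem_ae_restrict measurableSet_Ioo] with x hx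
      rw [norm_mul, Real.norm_eq_abs, abs_of_pos (hf.pos x hx)]
      have h1 := hC (x - t) ⟨by linarith [hx.1, ht.2], by linarith [hx.2, ht.1]⟩
      exact (mul_le_of_le_one_left (norm_nonneg _) (hf.le_one x hx)).trans h1
    · exact integrableOn_const (by simp)
    · exact Eventually.of_forall fun x =>
        (continuous_const.mul (hψ.comp (continuous_const.sub continuous_id))).continuousOn
  have h0 : 0 ≤ ∫ x in Ioo (0 : ℝ) 1, f x * |x - 0| ^ (p - 2) * (x - 0) := by
    refine setIntegral_nonneg measurableSet_Ioo fun x hx => ?_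
    have := hf.pos x hx
    have := hx.1
    exact mul_nonneg (by positivity) (by linarith)
  have h1 : ∫ x in Ioo (0 : ℝ) 1, f x * |x - 1| ^ (p - 2) * (x - 1) ≤ 0 := by
    refine setIntegral_nonpos measurableSet_Ioo fun x hx => ?_
    have := hf.pos x hx
    exact mul_nonpos_of_nonneg_of_nonpos (by positivity) (by linarith [hx.2])
  obtain ⟨t, -, ht⟩ := intermediate_value_Icc' zero_le_one hc ⟨h1, h0⟩
  exact ⟨t, ht⟩

theorem IsUnitWeight.le_muP1 {p M : ℝ} {f : ℝ → ℝ} (hp : 1 < p) (hf : IsUnitWeight f)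
    (hM : ∀ (u : ℝ → ℝ) (K : NNReal), LipschitzWith K u →
      ∫ x in Ioo (0 : ℝ) 1, f x * |u x| ^ (p - 2) * u x = 0 →
      M * ∫ x in Ioo (0 : ℝ) 1, f x * |u x| ^ p ≤
        ∫ x in Ioo (0 : ℝ) 1, f x * |deriv u x| ^ p) :
    M ≤ muP1 p (Ioo 0 1) f := by
  apply le_csInf
  · obtain ⟨t, ht⟩ := exists_integral_abs_sub_rpow_mul_eq_zero hp hf
    refine ⟨_, fun x => x - t, 1, LipschitzWith.of_dist_le_mul fun x y => by simp, fun h => ?_,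
      ht, rfl⟩
    have h1 : ∀ᵐ x ∂volume.restrict (Ioo (0 : ℝ) 1), x ≠ t :=
      ae_restrict_of_ae (by simp [ae_iff])
    have h2 : ∀ᵐ x ∂volume.restrict (Ioo (0 : ℝ) 1), False := by
      filter_upwards [h, h1] with x hx hxt using hxt (sub_eq_zero.1 hx)
    rw [ae_iff] at h2
    simp at h2
  · rintro _ ⟨u, K, hu, hne, hmean, rfl⟩
    rw [le_div_iff₀ (integral_weight_mul_abs_rpow_pos hp hf hu.continuous hne)]
    exact hM u K hu hmean

theorem IsWeightPair.le_muP1 {p K₁ κ : ℝ} {h φ : ℝ → ℝ} (hp : 1 < p)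
    (H : IsWeightPair h φ) (hK0 : 0 < K₁) (hK : GainConstant p K₁) (hκ : κ ∈ Icc (0 : ℝ) 4)
    (hκh : ∀ x ∈ Icc (1 / 4 : ℝ) (3 / 4), 4 * κ ≤ (deriv h x / h x) ^ 2) :
    piP p ^ p + K₁ * κ ≤ muP1 p (Ioo 0 1) fun x => h x * φ x := by
  have hpi : 0 < piP p ^ p := Real.rpow_pos_of_pos (piP_pos hp) p
  have hKκ : 0 ≤ K₁ * κ := mul_nonneg hK0.le hκ.1
  refine le_of_forall_lt_imp_le_of_dense fun l' hl' => ?_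
  refine (le_max_left l' (piP p ^ p / 2)).trans ?_
  set l := max l' (piP p ^ p / 2)
  have hl : piP p ^ p / 2 ≤ l := le_max_right _ _
  refine H.isUnitWeight.le_muP1 hp fun u K hu hmean => ?_
  obtain ⟨c, hc⟩ := H.exists_poincare_sub hp hK hκ hκh hl (max_lt hl' (by linarith)) hu
  refine le_trans ?_ hc
  exact mul_le_mul_of_nonneg_left
    (integral_abs_rpow_le_integral_abs_sub_rpow hp H.isUnitWeight hu.continuous hmean c)
    (by linarith)

theorem ConcaveOn.log_of_rpow_inv_natCast {s : Set ℝ} {φ : ℝ → ℝ} {m : ℕ} (hm : 0 < m)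
    (hpos : ∀ x ∈ s, 0 < φ x) (hφ : ConcaveOn ℝ s fun x => φ x ^ ((1 : ℝ) / m)) :
    ConcaveOn ℝ s fun x => Real.log (φ x) := by
  have hm' : (0 : ℝ) < m := Nat.cast_pos.2 hm
  have h1 := (hφ.log_of_pos fun x hx => Real.rpow_pos_of_pos (hpos x hx) _).smul hm'.le
  refine h1.congr fun x hx => ?_
  simp only [smul_eq_mul]
  rw [Real.log_rpow (hpos x hx)]
  field_simp

/-- Proposition 4.1: one-dimensional refined nonlinear Poincaré
inequality.  There exist explicit positive constants `K₁ = K₁(p,m)` and `K₃ = K₃(p,m) < 1/2`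
such that: for any weight `f = h φ` on `I = (0,1)` with `‖f‖_∞ = 1`, `h` positive concave
(and differentiable) and `φ` positive `(1/m)`-concave, if `μ_p(I,f) ≤ π_p^p + 1` then
`μ_p(I,f) ≥ π_p^p + K₁ min_{[K₃,1-K₃]} (h'/h)²`. -/
theorem stmt9 (p : ℝ) (hp : 1 < p) (m : ℕ) (hm : 0 < m) :
    ∃ K₁ K₃ : ℝ, 0 < K₁ ∧ 0 < K₃ ∧ K₃ < 1 / 2 ∧
      ∀ h φ : ℝ → ℝ,
        (∀ x ∈ Set.Ioo (0 : ℝ) 1, 0 < h x) →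
        ConcaveOn ℝ (Set.Ioo (0 : ℝ) 1) h →
        DifferentiableOn ℝ h (Set.Ioo (0 : ℝ) 1) →
        (∀ x ∈ Set.Ioo (0 : ℝ) 1, 0 < φ x) →
        ConcaveOn ℝ (Set.Ioo (0 : ℝ) 1) (fun x => φ x ^ ((1 : ℝ) / m)) →
        sSup ((fun x => h x * φ x) '' Set.Ioo (0 : ℝ) 1) = 1 →
        muP1 p (Set.Ioo 0 1) (fun x => h x * φ x) ≤ piP p ^ p + 1 →
        muP1 p (Set.Ioo 0 1) (fun x => h x * φ x) ≥
          piP p ^ p +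
            K₁ * sInf ((fun x => (deriv h x / h x) ^ 2) '' Set.Icc K₃ (1 - K₃)) := by
  obtain ⟨K, hK0, hK⟩ := exists_gain hp
  refine ⟨K / 4, 1 / 4, by positivity, by norm_num, by norm_num,
    fun h φ hh hconc hdiff hφ hφconc hsup _ => ?_⟩
  have hbdd : BddAbove ((fun x => h x * φ x) '' Ioo (0 : ℝ) 1) := by
    by_contra hb
    rw [Real.sSup_of_not_bddAbove hb] at hsup
    exact zero_ne_one hsup
  have H : IsWeightPair h φ :=
    ⟨hh, hconc, hdiff, hφ, hφconc.log_of_rpow_inv_natCast hm hφ,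
      fun x hx => hsup ▸ le_csSup hbdd (mem_image_of_mem _ hx)⟩
  rw [show (1 : ℝ) - 1 / 4 = 3 / 4 by norm_num]
  set S := (fun x => (deriv h x / h x) ^ 2) '' Icc (1 / 4 : ℝ) (3 / 4) with hS
  have hS0 : ∀ y ∈ S, 0 ≤ y := by
    rintro _ ⟨x, -, rfl⟩
    positivity
  have hSle : ∀ x ∈ Icc (1 / 4 : ℝ) (3 / 4), sInf S ≤ (deriv h x / h x) ^ 2 := fun x hx =>
    csInf_le ⟨0, hS0⟩ (mem_image_of_mem _ hx)
  have hhalf := (hSle (1 / 2) (by norm_num)).trans H.logDeriv_left_half_sq_le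
  have hnonneg := Real.sInf_nonneg hS0
  have := H.le_muP1 (κ := sInf S / 4) hp hK0 hK ⟨by linarith, by linarith⟩ fun x hx => by
    linarith [hSle x hx]
  linarith
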